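/- arXiv:2207.11071 — 7 statements merged into one kernel-verified Lean document; each statement's English description precedes it below -/
import Mathlib

section
/- For every natural number d and every real r with 0 ≤ r ≤ 1/2, it holds that r^{d+1}·(1−2r)² ≤ 2·(1/2)^d·(d+1)^{d+1}/(d+3)^{d+3}; moreover the function r ↦ r^{d+1}(1−2r)² on [0,1/2] attains this maximum value at r = (1/2)·(d+1)/(d+3). -/
/-- An integer-weighted AM-GM inequality: nonnegative reals whose weighted mean is `1` have
weighted product at most `1`. -/
theorem pow_mul_pow_le_one_of_weighted_sum_eq {m n : ℕ} {x y : ℝ} (hx : 0 ≤ x) (hy : 0 ≤ y)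
    (h : m * x + n * y = m + n) : x ^ m * y ^ n ≤ 1 := by
  have key (z : ℝ) : z ≤ Real.exp (z - 1) := by linarith [Real.add_one_le_exp (z - 1)]
  calc x ^ m * y ^ n ≤ Real.exp (x - 1) ^ m * Real.exp (y - 1) ^ n := by
        gcongr <;> exact key _
    _ = Real.exp (m * (x - 1) + n * (y - 1)) := by
        rw [Real.exp_add, Real.exp_nat_mul, Real.exp_nat_mul]
    _ = 1 := by rw [Real.exp_eq_one_iff]; linarith

/-- For every natural number `d` and every real `0 ≤ r ≤ 1/2`,
`r^(d+1)·(1-2r)² ≤ 2·(1/2)^d·(d+1)^(d+1)/(d+3)^(d+3)`; moreover the function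
`r ↦ r^(d+1)·(1-2r)²` attains this maximum value at `r = (1/2)·(d+1)/(d+3)`. -/
theorem pow_mul_sq_max (d : ℕ) :
    (∀ r : ℝ, 0 ≤ r → r ≤ 1 / 2 →
      r ^ (d + 1) * (1 - 2 * r) ^ 2 ≤
        2 * (1 / 2 : ℝ) ^ d * ((d : ℝ) + 1) ^ (d + 1) / ((d : ℝ) + 3) ^ (d + 3)) ∧
    (1 / 2 * (((d : ℝ) + 1) / ((d : ℝ) + 3))) ^ (d + 1) *
        (1 - 2 * (1 / 2 * (((d : ℝ) + 1) / ((d : ℝ) + 3)))) ^ 2 =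
      2 * (1 / 2 : ℝ) ^ d * ((d : ℝ) + 1) ^ (d + 1) / ((d : ℝ) + 3) ^ (d + 3) := by
  have h1 : (0 : ℝ) < (d : ℝ) + 1 := by positivity
  have h3 : (0 : ℝ) < (d : ℝ) + 3 := by positivity
  have hmax : (1 / 2 * (((d : ℝ) + 1) / ((d : ℝ) + 3))) ^ (d + 1) *
        (1 - 2 * (1 / 2 * (((d : ℝ) + 1) / ((d : ℝ) + 3)))) ^ 2 =
      2 * (1 / 2 : ℝ) ^ d * ((d : ℝ) + 1) ^ (d + 1) / ((d : ℝ) + 3) ^ (d + 3) := by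
    have hs : 1 - 2 * (1 / 2 * (((d : ℝ) + 1) / ((d : ℝ) + 3))) = 2 / ((d : ℝ) + 3) := by
      field_simp
      ring
    rw [hs, mul_pow, div_pow ((d : ℝ) + 1), div_pow 2, pow_succ (1 / 2 : ℝ) d,
      show d + 3 = (d + 1) + 2 from rfl, pow_add _ (d + 1) 2]
    field_simp
  refine ⟨fun r hr0 hr1 => ?_, hmax⟩
  rw [← hmax]
  set s : ℝ := 1 / 2 * (((d : ℝ) + 1) / ((d : ℝ) + 3)) with hs
  have hs0 : 0 < s := by positivity
  have ht : 1 - 2 * s = 2 / ((d : ℝ) + 3) := by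
    rw [hs]
    field_simp
    ring
  have ht0 : 0 < 1 - 2 * s := by rw [ht]; positivity
  have amgm : (r / s) ^ (d + 1) * ((1 - 2 * r) / (1 - 2 * s)) ^ 2 ≤ 1 := by
    refine pow_mul_pow_le_one_of_weighted_sum_eq (by positivity)
      (div_nonneg (by linarith) ht0.le) ?_
    rw [ht, hs]
    push_cast
    field_simp
    ring
  rwa [div_pow, div_pow, div_mul_div_comm, div_le_one (by positivity)] at amgm
end

section
/- For every real ε ≥ 0, every integer d ≥ 1 and every real r with 0 ≤ r < 1/2, it holds that 1.014·1.147·ε·(r²(1−2r)³/((1−2r)(1−r)))·r^{d−1} ≤ 4.652232·ε·(1/2)^d·(d+1)^{d+1}/(d+3)^{d+3}. -/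
/-- Weighted AM-GM: `x ^ n * (1 - x) ^ 2` is maximal on `[0, 1]` at `x = n / (n + 2)`. -/
theorem pow_mul_one_sub_sq_le (n : ℕ) (hn : 0 < n) {x : ℝ} (hx0 : 0 ≤ x) (hx1 : x ≤ 1) :
    x ^ n * (1 - x) ^ 2 ≤ 4 * (n : ℝ) ^ n / ((n : ℝ) + 2) ^ (n + 2) := by
  have hn' : (0 : ℝ) < n := by exact_mod_cast hn
  set u : ℝ := x * (n + 2) / n with hu
  set v : ℝ := (1 - x) * (n + 2) / 2 with hv
  have hu0 : 0 ≤ u := by positivity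
  have hv0 : 0 ≤ v := by have := sub_nonneg.2 hx1; positivity
  have key : u ^ n * v ^ 2 ≤ 1 := by
    calc u ^ n * v ^ 2 ≤ Real.exp (u - 1) ^ n * Real.exp (v - 1) ^ 2 := by
          gcongr <;> linarith [Real.add_one_le_exp (u - 1), Real.add_one_le_exp (v - 1)]
      _ = 1 := by
          rw [← Real.exp_nat_mul, ← Real.exp_nat_mul, ← Real.exp_add, Real.exp_eq_one_iff, hu, hv]
          push_cast
          field_simp
          ring
  rw [le_div_iff₀ (by positivity)]
  calc x ^ n * (1 - x) ^ 2 * ((n : ℝ) + 2) ^ (n + 2) = 4 * (n : ℝ) ^ n * (u ^ n * v ^ 2) := by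
        rw [hu, hv, div_pow, mul_pow, pow_add]
        field_simp
        ring
    _ ≤ 4 * (n : ℝ) ^ n := mul_le_of_le_one_right (by positivity) key


/-- For every real `ε ≥ 0`, integer `d ≥ 1` and real `0 ≤ r < 1/2`:
`1.014·1.147·ε·(r²(1-2r)³/((1-2r)(1-r)))·r^(d-1)
  ≤ 4.652232·ε·(1/2)^d·(d+1)^(d+1)/(d+3)^(d+3)`. -/
theorem nonroot_bias_bound (ε : ℝ) (hε : 0 ≤ ε) (d : ℕ) (hd : 1 ≤ d)
    (r : ℝ) (hr0 : 0 ≤ r) (hr : r < 1 / 2) :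
    1.014 * 1.147 * ε * (r ^ 2 * (1 - 2 * r) ^ 3 / ((1 - 2 * r) * (1 - r))) * r ^ (d - 1) ≤
      4.652232 * ε * (1 / 2 : ℝ) ^ d * ((d : ℝ) + 1) ^ (d + 1) / ((d : ℝ) + 3) ^ (d + 3) := by
  have amgm := pow_mul_one_sub_sq_le (d + 1) d.succ_pos (x := 2 * r) (by linarith) (by linarith)
  push_cast at amgm
  rw [show (d : ℝ) + 1 + 2 = d + 3 by ring, show d + 1 + 2 = d + 3 by ring, mul_pow] at amgm
  have h1 : 0 < 1 - 2 * r := by linarith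
  have h2 : 0 < 1 - r := by linarith
  have hinv : 1 / (1 - r) ≤ 2 := by rw [div_le_iff₀ h2]; linarith
  obtain ⟨k, rfl⟩ : ∃ k, d = k + 1 := ⟨d - 1, by omega⟩
  simp only [Nat.add_sub_cancel]
  set B : ℝ := (((k + 1 : ℕ) : ℝ) + 1) ^ (k + 1 + 1) / (((k + 1 : ℕ) : ℝ) + 3) ^ (k + 1 + 3) with hB
  have hp : (1 / 2 : ℝ) ^ (k + 1 + 1) * 2 ^ (k + 1 + 1) = 1 := by
    rw [← mul_pow]; norm_num
  calc 1.014 * 1.147 * ε * (r ^ 2 * (1 - 2 * r) ^ 3 / ((1 - 2 * r) * (1 - r))) * r ^ k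
      = 1.163058 * ε * (r ^ (k + 1 + 1) * (1 - 2 * r) ^ 2) * (1 / (1 - r)) := by
        field_simp
        ring
    _ ≤ 1.163058 * ε * (r ^ (k + 1 + 1) * (1 - 2 * r) ^ 2) * 2 := by gcongr
    _ = 1.163058 * ε * 2 * (1 / 2 : ℝ) ^ (k + 1 + 1) *
          (2 ^ (k + 1 + 1) * r ^ (k + 1 + 1) * (1 - 2 * r) ^ 2) := by
        linear_combination
          (-(1.163058 * ε * 2 * (r ^ (k + 1 + 1) * (1 - 2 * r) ^ 2))) * hp
    _ ≤ 1.163058 * ε * 2 * (1 / 2 : ℝ) ^ (k + 1 + 1) * (4 * B) := by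
        rw [hB, ← mul_div_assoc]
        gcongr
    _ = 4.652232 * ε * (1 / 2 : ℝ) ^ (k + 1) * B := by ring
    _ = _ := by rw [hB, ← mul_div_assoc]
end

section
/- The integral ∫_0^{1/2} r²(1−2r)^5/(1−r)^4 dr equals 170·ln 2 − 707/6, and this value is at least 0.00168728. -/
open intervalIntegral

/-- An antiderivative of `(1-u)²(2u-1)⁵/u⁴`, found by partial fractions. -/
theorem hasDerivAt_correlation_antideriv {u : ℝ} (hu : u ≠ 0) :
    HasDerivAt (fun u : ℝ => 8 * u ^ 4 - 48 * u ^ 3 + 136 * u ^ 2 - 280 * u + 170 * Real.log u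
      + 61 * u⁻¹ - 6 * (u ^ 2)⁻¹ + 1 / 3 * (u ^ 3)⁻¹)
      ((1 - u) ^ 2 * (2 * u - 1) ^ 5 / u ^ 4) u := by
  have h := (((((((((hasDerivAt_pow 4 u).const_mul 8).fun_sub
    ((hasDerivAt_pow 3 u).const_mul 48)).fun_add
    ((hasDerivAt_pow 2 u).const_mul 136)).fun_sub
    ((hasDerivAt_id' u).const_mul 280)).fun_add
    ((Real.hasDerivAt_log hu).const_mul 170)).fun_add
    ((hasDerivAt_inv hu).const_mul 61)).fun_sub
    (((hasDerivAt_pow 2 u).fun_inv (pow_ne_zero 2 hu)).const_mul 6)).fun_add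
    (((hasDerivAt_pow 3 u).fun_inv (pow_ne_zero 3 hu)).const_mul (1 / 3)))
  refine h.congr_deriv ?_
  norm_num
  field_simp
  ring

/-- `∫_0^{1/2} r²(1-2r)⁵/(1-r)⁴ dr = 170·ln 2 − 707/6`, and this value is at
least `0.00168728`. -/
theorem correlation_bonus_integral :
    (∫ r in (0 : ℝ)..(1 / 2), r ^ 2 * (1 - 2 * r) ^ 5 / (1 - r) ^ 4) =
      170 * Real.log 2 - 707 / 6 ∧
    (0.00168728 : ℝ) ≤ 170 * Real.log 2 - 707 / 6 := by
  constructor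
  · have hne : ∀ u ∈ Set.uIcc (1 / 2 : ℝ) 1, u ≠ 0 := by
      intro u hu
      rw [Set.uIcc_of_le (by norm_num)] at hu
      linarith [hu.1]
    have hsubst : (∫ r in (0 : ℝ)..(1 / 2), r ^ 2 * (1 - 2 * r) ^ 5 / (1 - r) ^ 4) =
        ∫ u in (1 / 2 : ℝ)..1, (1 - u) ^ 2 * (2 * u - 1) ^ 5 / u ^ 4 := by
      have h := integral_comp_sub_left (a := 0) (b := 1 / 2)
        (fun u : ℝ => (1 - u) ^ 2 * (2 * u - 1) ^ 5 / u ^ 4) 1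
      rw [show (1 : ℝ) - 1 / 2 = 1 / 2 by norm_num, sub_zero] at h
      rw [← h]
      congr 1
      ext r
      ring
    have hcont : ContinuousOn (fun u : ℝ => (1 - u) ^ 2 * (2 * u - 1) ^ 5 / u ^ 4)
        (Set.uIcc (1 / 2) 1) :=
      ContinuousOn.div (by fun_prop) (by fun_prop) fun u hu => pow_ne_zero 4 (hne u hu)
    rw [hsubst, integral_eq_sub_of_hasDerivAt
      (fun u hu => hasDerivAt_correlation_antideriv (hne u hu)) hcont.intervalIntegrable,
      one_div 2, Real.log_inv, Real.log_one]
    ring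
  · linarith [Real.log_two_gt_d9]
end

section
/- ∫_0^{1/2} (r²/(1−r)²)·B(r)·25r²(1−2r)(3−10r) dr = 1522565/42 − 52300·ln 2; moreover 0 ≤ 52300·ln 2 − 1522565/42 ≤ 0.05. -/
/-- `B(r) = 1 + (1-2r)²(1-2r+2r²)/(1-r)²` for `0 ≤ r < 1/2` and `B(r) = 1` for
`1/2 ≤ r ≤ 1`. -/
noncomputable def B (r : ℝ) : ℝ :=
  if r < 1 / 2 then 1 + (1 - 2 * r) ^ 2 * (1 - 2 * r + 2 * r ^ 2) / (1 - r) ^ 2 else 1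

/-- On `[0, 1/2]` the first branch of `B` is valid up to and including the endpoint. -/
theorem B_of_le_half {r : ℝ} (hr : r ≤ 1 / 2) :
    B r = 1 + (1 - 2 * r) ^ 2 * (1 - 2 * r + 2 * r ^ 2) / (1 - r) ^ 2 := by
  rcases hr.lt_or_eq with h | rfl
  · exact if_pos h
  · norm_num [B]

/-- An antiderivative of the integrand, up to sign, in the variable `s = 1 - r`. -/
noncomputable def primitiveDFS2CC (s : ℝ) : ℝ :=
  -(175 / 3) * (s⁻¹) ^ 3 + 1175 * (s⁻¹) ^ 2 - 14375 * s⁻¹ - 52300 * Real.log s + 124825 * s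
    - 102075 * s ^ 2 + 77375 * s ^ 3 - 45400 * s ^ 4 + 18740 * s ^ 5 - 4800 * s ^ 6
    + 4000 / 7 * s ^ 7

theorem hasDerivAt_primitiveDFS2CC {s : ℝ} (hs : s ≠ 0) :
    HasDerivAt primitiveDFS2CC
      (25 * (1 - s) ^ 4 * (2 * s - 1) * (10 * s - 7)
        * (s ^ 2 + (2 * s - 1) ^ 2 * (2 * s ^ 2 - 2 * s + 1)) / s ^ 4) s := by
  have hi := hasDerivAt_inv hs
  have hd := (((((((((((hi.fun_pow 3).const_mul (-(175 / 3))).fun_add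
    ((hi.fun_pow 2).const_mul 1175)).fun_sub (hi.const_mul 14375)).fun_sub
    ((Real.hasDerivAt_log hs).const_mul 52300)).fun_add
    ((hasDerivAt_id' s).const_mul 124825)).fun_sub
    ((hasDerivAt_pow 2 s).const_mul 102075)).fun_add
    ((hasDerivAt_pow 3 s).const_mul 77375)).fun_sub
    ((hasDerivAt_pow 4 s).const_mul 45400)).fun_add
    ((hasDerivAt_pow 5 s).const_mul 18740)).fun_sub
    ((hasDerivAt_pow 6 s).const_mul 4800)).fun_add
    ((hasDerivAt_pow 7 s).const_mul (4000 / 7))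
  refine hd.congr_deriv ?_
  push_cast
  field_simp
  ring

theorem integral_eq_primitiveDFS2CC :
    (∫ r in (0 : ℝ)..(1 / 2),
        r ^ 2 / (1 - r) ^ 2 * B r * (25 * r ^ 2 * (1 - 2 * r) * (3 - 10 * r))) =
      primitiveDFS2CC 1 - primitiveDFS2CC (1 / 2) := by
  let f : ℝ → ℝ := fun s => 25 * (1 - s) ^ 4 * (2 * s - 1) * (10 * s - 7)
    * (s ^ 2 + (2 * s - 1) ^ 2 * (2 * s ^ 2 - 2 * s + 1)) / s ^ 4
  have hpos : ∀ s ∈ Set.uIcc (1 / 2 : ℝ) 1, s ≠ 0 := by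
    intro s hs
    rw [Set.uIcc_of_le (by norm_num)] at hs
    exact (show 0 < s by linarith [hs.1]).ne'
  have hf : ∫ s in (1 / 2 : ℝ)..1, f s = primitiveDFS2CC 1 - primitiveDFS2CC (1 / 2) := by
    refine intervalIntegral.integral_eq_sub_of_hasDerivAt
      (fun s hs => hasDerivAt_primitiveDFS2CC (hpos s hs)) ?_
    refine ContinuousOn.intervalIntegrable ?_
    exact ContinuousOn.div (by fun_prop) (by fun_prop) fun s hs => pow_ne_zero 4 (hpos s hs)
  have hsub := intervalIntegral.integral_comp_sub_left (a := 0) (b := 1 / 2) f 1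
  rw [show (1 : ℝ) - 1 / 2 = 1 / 2 by norm_num, sub_zero, hf] at hsub
  rw [← hsub]
  refine intervalIntegral.integral_congr fun r hr => ?_
  rw [Set.uIcc_of_le (by norm_num)] at hr
  have h1 : 1 - r ≠ 0 := (show 0 < 1 - r by linarith [hr.2]).ne'
  simp only [f, B_of_le_half hr.2]
  field_simp
  ring

/-- `∫_0^{1/2} (r²/(1-r)²)·B(r)·25r²(1-2r)(3-10r) dr = 1522565/42 − 52300·ln 2`;
moreover `0 ≤ 52300·ln 2 − 1522565/42 ≤ 0.05` (the constant DFS2CC). -/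
theorem integral_DFS2CC :
    (∫ r in (0 : ℝ)..(1 / 2),
        r ^ 2 / (1 - r) ^ 2 * B r * (25 * r ^ 2 * (1 - 2 * r) * (3 - 10 * r))) =
      1522565 / 42 - 52300 * Real.log 2 ∧
    (0 : ℝ) ≤ 52300 * Real.log 2 - 1522565 / 42 ∧
    52300 * Real.log 2 - 1522565 / 42 ≤ 0.05 := by
  refine ⟨?_, by linarith [Real.log_two_gt_d9], by linarith [Real.log_two_lt_d9]⟩
  rw [integral_eq_primitiveDFS2CC]
  simp only [primitiveDFS2CC, one_div, Real.log_one, Real.log_inv]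
  ring
end

section
/- ∫_0^{1/2} 4r³(1−2r)³·B(r)/(1−r)^4 dr = 7908·ln 2 − 27407/5; moreover 1.147·(7908·ln 2 − 27407/5) ≤ 0.0091. -/
/-- An antiderivative, as a function of `t = 1 - r`, of the integrand below the threshold `1 / 2`. -/
noncomputable def primitiveDFD2CC (t : ℝ) : ℝ :=
  4 / 5 * t⁻¹ ^ 5 - 15 * t⁻¹ ^ 4 + 136 * t⁻¹ ^ 3 - 824 * t⁻¹ ^ 2 + 4364 * t⁻¹ + 7908 * Real.log t
    - 9944 * t + 4296 * t ^ 2 - 1632 * t ^ 3 + 416 * t ^ 4 - 256 / 5 * t ^ 5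

theorem hasDerivAt_primitiveDFD2CC {t : ℝ} (ht : t ≠ 0) :
    HasDerivAt primitiveDFD2CC
      (4 * (1 - t) ^ 3 * (2 * t - 1) ^ 3
        * (1 + (2 * t - 1) ^ 2 * (2 * t ^ 2 - 2 * t + 1) / t ^ 2) / t ^ 4) t := by
  have hinv := hasDerivAt_inv ht
  have hid := hasDerivAt_id' t
  have h := ((((((((((((hinv.pow 5).const_mul (4 / 5)).sub ((hinv.pow 4).const_mul 15)).add
    ((hinv.pow 3).const_mul 136)).sub ((hinv.pow 2).const_mul 824)).add
    (hinv.const_mul 4364)).add ((Real.hasDerivAt_log ht).const_mul 7908)).sub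
    (hid.const_mul 9944)).add ((hid.pow 2).const_mul 4296)).sub
    ((hid.pow 3).const_mul 1632)).add ((hid.pow 4).const_mul 416)).sub
    ((hid.pow 5).const_mul (256 / 5)))
  refine h.congr_deriv ?_
  push_cast
  field_simp
  ring

theorem integrand_DFD2CC_eq {r : ℝ} (hr : r ≤ 1 / 2) :
    4 * r ^ 3 * (1 - 2 * r) ^ 3 * B r / (1 - r) ^ 4 =
      4 * r ^ 3 * (1 - 2 * r) ^ 3
        * (1 + (1 - 2 * r) ^ 2 * (1 - 2 * r + 2 * r ^ 2) / (1 - r) ^ 2) / (1 - r) ^ 4 := by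
  rcases hr.lt_or_eq with h | rfl
  · rw [B, if_pos h]
  · norm_num

/-- `∫_0^{1/2} 4r³(1-2r)³·B(r)/(1-r)⁴ dr = 7908·ln 2 − 27407/5`; moreover
`1.147·(7908·ln 2 − 27407/5) ≤ 0.0091` (the constant DFD2CC). -/
theorem integral_DFD2CC :
    (∫ r in (0 : ℝ)..(1 / 2), 4 * r ^ 3 * (1 - 2 * r) ^ 3 * B r / (1 - r) ^ 4) =
      7908 * Real.log 2 - 27407 / 5 ∧
    1.147 * (7908 * Real.log 2 - 27407 / 5) ≤ 0.0091 := by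
  refine ⟨?_, by linarith [Real.log_two_lt_d9]⟩
  have hle : ∀ r ∈ Set.uIcc (0 : ℝ) (1 / 2), r ≤ 1 / 2 := fun r hr ↦ by
    rw [Set.uIcc_of_le (by norm_num)] at hr
    exact hr.2
  have hne : ∀ r ∈ Set.uIcc (0 : ℝ) (1 / 2), 1 - r ≠ 0 := fun r hr ↦ by
    have := hle r hr
    exact ne_of_gt (by linarith)
  rw [intervalIntegral.integral_congr fun r hr ↦ integrand_DFD2CC_eq (hle r hr),
    intervalIntegral.integral_eq_sub_of_hasDerivAt (f := fun r ↦ -primitiveDFD2CC (1 - r))]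
  · have hlog : Real.log (1 / 2) = -Real.log 2 := by rw [one_div, Real.log_inv]
    norm_num [primitiveDFD2CC, hlog]
    ring
  · intro r hr
    have h := ((hasDerivAt_primitiveDFD2CC (hne r hr)).comp r
      ((hasDerivAt_id' r).const_sub 1)).neg
    refine h.congr_deriv ?_
    ring
  · refine ContinuousOn.intervalIntegrable ?_
    have hne2 : ∀ r ∈ Set.uIcc (0 : ℝ) (1 / 2), (1 - r) ^ 2 ≠ 0 := fun r hr ↦
      pow_ne_zero 2 (hne r hr)
    have hne4 : ∀ r ∈ Set.uIcc (0 : ℝ) (1 / 2), (1 - r) ^ 4 ≠ 0 := fun r hr ↦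
      pow_ne_zero 4 (hne r hr)
    fun_prop (disch := assumption)
end

section
/- For every integer d ≥ 19, ∫_θ^{1/2} ((1−2r)²/(1−r)³)·r^d dr ≥ (4/5)·2^{−d}/((d+1)(d+3)³), where θ = (5−√17)/2. -/
/-- The bound `((d - 1) / (d + 1)) ^ d ≥ 1 / 10`, in the range `d ≥ 19`. -/
lemma one_tenth_le_sub_one_div_add_one_pow (d : ℕ) (hd : 19 ≤ d) :
    (1 / 10 : ℝ) ≤ (((d : ℝ) - 1) / (d + 1)) ^ d := by
  have hd' : (19 : ℝ) ≤ d := by exact_mod_cast hd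
  have hpos : (0 : ℝ) < d - 1 := by linarith
  have hexp : Real.exp (19 / 9) ≤ 10 := by
    have h : Real.exp (19 / 9) ^ 9 ≤ 10 ^ 9 := by
      have hpow : Real.exp (19 / 9) ^ 9 = Real.exp 1 ^ 19 := by
        rw [← Real.exp_nat_mul, ← Real.exp_nat_mul]
        norm_num
      calc Real.exp (19 / 9) ^ 9 = Real.exp 1 ^ 19 := hpow
        _ ≤ 2.7182818286 ^ 19 := by
          gcongr
          exact Real.exp_one_lt_d9.le
        _ ≤ 10 ^ 9 := by norm_num
    exact le_of_pow_le_pow_left₀ (by norm_num) (by norm_num) h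
  have hinv : (((d : ℝ) + 1) / (d - 1)) ^ d ≤ 10 := by
    calc (((d : ℝ) + 1) / (d - 1)) ^ d ≤ Real.exp (2 / (d - 1)) ^ d := by
          gcongr
          have h := Real.add_one_le_exp (2 / ((d : ℝ) - 1))
          have heq : ((d : ℝ) + 1) / (d - 1) = 2 / (d - 1) + 1 := by
            field_simp
            ring
          rwa [heq]
      _ = Real.exp (d * (2 / (d - 1))) := (Real.exp_nat_mul _ _).symm
      _ ≤ Real.exp (19 / 9) := by
          gcongr
          rw [← mul_div_assoc, div_le_div_iff₀ hpos (by norm_num)]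
          linarith
      _ ≤ 10 := hexp
  rw [← inv_div ((d : ℝ) + 1), inv_pow, one_div]
  exact inv_anti₀ (by positivity) hinv

/-- For every integer `d ≥ 19`:
`∫_θ^{1/2} ((1−2r)²/(1−r)³)·r^d dr ≥ (4/5)·2^(−d)/((d+1)(d+3)³)`,
where `θ = (5−√17)/2`. -/
theorem integral_g_pow_lower_bound (d : ℕ) (hd : 19 ≤ d) :
    (∫ r in ((5 - Real.sqrt 17) / 2 : ℝ)..(1 / 2),
        (1 - 2 * r) ^ 2 / (1 - r) ^ 3 * r ^ d) ≥
      4 / 5 * ((2 : ℝ) ^ d)⁻¹ / (((d : ℝ) + 1) * ((d : ℝ) + 3) ^ 3) := by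
  have hd' : (19 : ℝ) ≤ d := by exact_mod_cast hd
  set θ : ℝ := (5 - Real.sqrt 17) / 2 with hθ
  set f : ℝ → ℝ := fun r => (1 - 2 * r) ^ 2 / (1 - r) ^ 3 * r ^ d with hf
  set a : ℝ := 1 / 2 * ((d - 1) / (d + 1)) with ha
  set b : ℝ := 1 / 2 * ((d + 1) / (d + 3)) with hb
  have hsqrt_lo : 4.1 ≤ Real.sqrt 17 := Real.le_sqrt_of_sq_le (by norm_num)
  have hsqrt_hi : Real.sqrt 17 ≤ 5 := Real.sqrt_le_iff.2 (by norm_num)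
  have hθ0 : 0 ≤ θ := by rw [hθ]; linarith
  have ha45 : 0.45 ≤ a := by
    have : (0.9 : ℝ) ≤ (d - 1) / (d + 1) := by
      rw [le_div_iff₀ (by positivity)]
      linarith
    rw [ha]; linarith
  have hθa : θ ≤ a := by rw [hθ]; linarith
  have hlen : b - a = 2 / ((d + 1) * (d + 3)) := by
    rw [ha, hb]
    field_simp
    ring
  have hab : a ≤ b := by
    have : 0 ≤ b - a := by rw [hlen]; positivity
    linarith
  have hbgap : 1 - 2 * b = 2 / (d + 3) := by
    rw [hb]
    field_simp
    ring
  have hb2 : b ≤ 1 / 2 := by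
    have : 0 ≤ 1 - 2 * b := by rw [hbgap]; positivity
    linarith
  have hcont : ContinuousOn f (Set.Icc θ (1 / 2)) := by
    refine ContinuousOn.mul (ContinuousOn.div (by fun_prop) (by fun_prop) ?_) (by fun_prop)
    intro r hr
    have : 0 < 1 - r := by linarith [hr.2]
    positivity
  have hint : IntervalIntegrable f MeasureTheory.volume θ (1 / 2) :=
    hcont.intervalIntegrable_of_Icc (by linarith)
  have hintab : IntervalIntegrable f MeasureTheory.volume a b :=
    (hcont.mono (Set.Icc_subset_Icc hθa hb2)).intervalIntegrable_of_Icc hab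
  have hapow : 1 / 10 * ((2 : ℝ) ^ d)⁻¹ ≤ a ^ d := by
    rw [ha, mul_pow, one_div_pow, one_div ((2 : ℝ) ^ d), mul_comm]
    gcongr
    exact one_tenth_le_sub_one_div_add_one_pow d hd
  have hlower : ∀ r ∈ Set.Icc a b,
      (2 / ((d : ℝ) + 3)) ^ 2 * (1 / 10 * ((2 : ℝ) ^ d)⁻¹) ≤ f r := by
    intro r ⟨har, hrb⟩
    have hr1 : 0 < 1 - r := by linarith
    have hg : (2 / ((d : ℝ) + 3)) ^ 2 ≤ (1 - 2 * r) ^ 2 / (1 - r) ^ 3 := by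
      rw [← hbgap]
      calc (1 - 2 * b) ^ 2 ≤ (1 - 2 * r) ^ 2 :=
            pow_le_pow_left₀ (by linarith) (by linarith) 2
        _ ≤ (1 - 2 * r) ^ 2 / (1 - r) ^ 3 :=
            le_div_self (sq_nonneg _) (by positivity)
              (pow_le_one₀ hr1.le (by linarith))
    have hr : a ^ d ≤ r ^ d := pow_le_pow_left₀ (by linarith) har d
    exact mul_le_mul hg (hapow.trans hr) (by positivity) (by positivity)
  calc 4 / 5 * ((2 : ℝ) ^ d)⁻¹ / (((d : ℝ) + 1) * ((d : ℝ) + 3) ^ 3)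
      = ∫ _ in a..b, (2 / ((d : ℝ) + 3)) ^ 2 * (1 / 10 * ((2 : ℝ) ^ d)⁻¹) := by
        rw [intervalIntegral.integral_const, hlen, smul_eq_mul]
        field_simp
        norm_num
    _ ≤ ∫ r in a..b, f r :=
        intervalIntegral.integral_mono_on hab intervalIntegrable_const hintab hlower
    _ ≤ ∫ r in θ..(1 / 2), f r := by
        refine intervalIntegral.integral_mono_interval hθa hab hb2 ?_ hint
        filter_upwards [MeasureTheory.ae_restrict_mem measurableSet_Ioc] with r hr
        have hr0 : 0 ≤ r := hθ0.trans hr.1.le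
        have hr1 : 0 < 1 - r := by linarith [hr.2]
        simp only [hf, Pi.zero_apply]
        positivity
end

section
/- For every integer d ≥ 5, OCB*(d) ≥ MLB*(d), where OCB*(d) = 0.8948·∫_0^{1/2} (r(1−2r)/(1−r)²)·r^d dr and MLB*(d) = 0.9·∫_0^{1/2} ((1−2r)²/(1−r)³)·r^d dr. -/
open intervalIntegral in
/-- A Chebyshev-type inequality: if `f` changes sign once on `[0, b]`, from nonpositive to
nonnegative, then a nonnegative integral stays nonnegative after weighting by a power. -/
lemma integral_mul_pow_nonneg_of_sign_change {f : ℝ → ℝ} {b c : ℝ} (hb : 0 ≤ b) (hc : 0 ≤ c)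
    (hf : ContinuousOn f (Set.Icc 0 b))
    (hneg : ∀ r ∈ Set.Icc 0 b, r ≤ c → f r ≤ 0) (hpos : ∀ r ∈ Set.Icc 0 b, c ≤ r → 0 ≤ f r)
    (hint : 0 ≤ ∫ r in (0 : ℝ)..b, f r) (k : ℕ) :
    0 ≤ ∫ r in (0 : ℝ)..b, f r * r ^ k := by
  have hf' : ContinuousOn f (Set.uIcc 0 b) := by rwa [Set.uIcc_of_le hb]
  calc
    0 ≤ (∫ r in (0 : ℝ)..b, f r) * c ^ k := by positivity
    _ = ∫ r in (0 : ℝ)..b, f r * c ^ k := (integral_mul_const _ _).symm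
    _ ≤ ∫ r in (0 : ℝ)..b, f r * r ^ k := by
      refine integral_mono_on hb (hf'.mul continuousOn_const).intervalIntegrable
        (hf'.mul (continuous_pow k).continuousOn).intervalIntegrable fun r hr => ?_
      rcases le_total r c with h | h
      · exact mul_le_mul_of_nonpos_left (pow_le_pow_left₀ hr.1 h k) (hneg r hr h)
      · exact mul_le_mul_of_nonneg_left (pow_le_pow_left₀ hc h k) (hpos r hr h)

/-- The quadratic factor of the difference of the two integrands. -/
def gapFactor (r : ℝ) : ℝ := 0.8948 * (r * (1 - r)) - 0.9 * (1 - 2 * r)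

/-- The difference of the two integrands for `d = 5`. -/
noncomputable def gapIntegrand (r : ℝ) : ℝ := r ^ 5 * (1 - 2 * r) / (1 - r) ^ 3 * gapFactor r

lemma continuousOn_gapIntegrand : ContinuousOn gapIntegrand (Set.Icc 0 (1 / 2)) := by
  unfold gapIntegrand gapFactor
  refine ContinuousOn.mul (ContinuousOn.div (by fun_prop) (by fun_prop) fun r hr => ?_)
    (by fun_prop)
  have : 0 < 1 - r := by linarith [hr.2]
  positivity

lemma exists_gapFactor_eq_zero : ∃ c ∈ Set.Icc (0 : ℝ) (1 / 2), gapFactor c = 0 := by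
  have h := intermediate_value_Icc (show (0 : ℝ) ≤ 1 / 2 by norm_num) (f := gapFactor)
    (by unfold gapFactor; fun_prop)
  exact h (by constructor <;> norm_num [gapFactor])

lemma gapFactor_mono {r s : ℝ} (hrs : r ≤ s) (hs : s ≤ 1 / 2) : gapFactor r ≤ gapFactor s := by
  unfold gapFactor
  nlinarith [mul_nonneg (sub_nonneg.2 hrs) (show 0 ≤ 1 - r - s by linarith)]

/-- A primitive of `gapIntegrand` on `(-∞, 1)`. -/
noncomputable def gapPrimitive (r : ℝ) : ℝ :=
  -(9 / 20 * ((1 - r) ^ 2)⁻¹ - 18013 / 2500 * (1 - r)⁻¹ - 14651 / 625 * Real.log (1 - r)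
    + 97101 / 2500 * (1 - r) - 397 / 25 * (1 - r) ^ 2 + 2843 / 1500 * (1 - r) ^ 3
    + 6633 / 2500 * (1 - r) ^ 4 - 20081 / 12500 * (1 - r) ^ 5 + 2237 / 7500 * (1 - r) ^ 6)

lemma hasDerivAt_gapPrimitive {r : ℝ} (hr : r < 1) :
    HasDerivAt gapPrimitive (gapIntegrand r) r := by
  have hne : 1 - r ≠ 0 := by linarith
  have hu : HasDerivAt (fun x : ℝ => 1 - x) (-1) r := by
    simpa using (hasDerivAt_id r).const_sub 1
  have h := ((((((((((hu.pow 2).inv (pow_ne_zero 2 hne)).const_mul (9 / 20)).sub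
    ((hu.inv hne).const_mul (18013 / 2500))).sub ((hu.log hne).const_mul (14651 / 625))).add
    (hu.const_mul (97101 / 2500))).sub ((hu.pow 2).const_mul (397 / 25))).add
    ((hu.pow 3).const_mul (2843 / 1500))).add ((hu.pow 4).const_mul (6633 / 2500))).sub
    ((hu.pow 5).const_mul (20081 / 12500))).add ((hu.pow 6).const_mul (2237 / 7500)) |>.neg
  refine h.congr_deriv ?_
  simp only [gapIntegrand, gapFactor, Pi.pow_apply]
  field_simp
  ring

lemma integral_gapIntegrand_nonneg : 0 ≤ ∫ r in (0 : ℝ)..(1 / 2), gapIntegrand r := by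
  have huIcc : Set.uIcc (0 : ℝ) (1 / 2) = Set.Icc 0 (1 / 2) := Set.uIcc_of_le (by norm_num)
  rw [intervalIntegral.integral_eq_sub_of_hasDerivAt (f := gapPrimitive)
    (fun r hr => hasDerivAt_gapPrimitive (by rw [huIcc] at hr; linarith [hr.2]))
    (ContinuousOn.intervalIntegrable (huIcc ▸ continuousOn_gapIntegrand))]
  have hlog : Real.log (1 - 1 / 2) = -Real.log 2 := by
    rw [← Real.log_inv]; norm_num
  simp only [gapPrimitive, hlog, sub_zero, Real.log_one]
  norm_num
  linarith [Real.log_two_lt_d9]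

/-- For every integer `d ≥ 5`, `OCB*(d) ≥ MLB*(d)`, where
`OCB*(d) = 0.8948·∫_0^{1/2} (r(1−2r)/(1−r)²)·r^d dr` and
`MLB*(d) = 0.9·∫_0^{1/2} ((1−2r)²/(1−r)³)·r^d dr`. -/
theorem ocbstar_ge_mlbstar (d : ℕ) (hd : 5 ≤ d) :
    0.8948 * ∫ r in (0 : ℝ)..(1 / 2), r * (1 - 2 * r) / (1 - r) ^ 2 * r ^ d ≥
      0.9 * ∫ r in (0 : ℝ)..(1 / 2), (1 - 2 * r) ^ 2 / (1 - r) ^ 3 * r ^ d := by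
  obtain ⟨k, rfl⟩ := Nat.exists_eq_add_of_le hd
  obtain ⟨c, hc, hc0⟩ := exists_gapFactor_eq_zero
  have hle : (0 : ℝ) ≤ 1 / 2 := by norm_num
  have hweight : ∀ r ∈ Set.Icc (0 : ℝ) (1 / 2), 0 ≤ r ^ 5 * (1 - 2 * r) / (1 - r) ^ 3 := by
    intro r hr
    have h0 := hr.1
    have h1 : 0 ≤ 1 - 2 * r := by linarith [hr.2]
    have h2 : 0 ≤ 1 - r := by linarith [hr.2]
    positivity
  have key := integral_mul_pow_nonneg_of_sign_change hle hc.1 continuousOn_gapIntegrand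
    (fun r hr h => mul_nonpos_of_nonneg_of_nonpos (hweight r hr)
      ((gapFactor_mono h hc.2).trans_eq hc0))
    (fun r hr h => mul_nonneg (hweight r hr) (hc0.symm.trans_le (gapFactor_mono h hr.2)))
    integral_gapIntegrand_nonneg k
  have hne : ∀ r ∈ Set.uIcc (0 : ℝ) (1 / 2), 1 - r ≠ 0 := by
    intro r hr
    rw [Set.uIcc_of_le hle] at hr
    linarith [hr.2]
  rw [ge_iff_le, ← sub_nonneg, ← intervalIntegral.integral_const_mul,
    ← intervalIntegral.integral_const_mul, ← intervalIntegral.integral_sub]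
  · refine key.trans_eq (intervalIntegral.integral_congr fun r hr => ?_)
    have := hne r hr
    simp only [gapIntegrand, gapFactor]
    field_simp
    ring
  all_goals
    refine ContinuousOn.intervalIntegrable (continuousOn_const.mul (ContinuousOn.mul
      (ContinuousOn.div (by fun_prop) (by fun_prop) fun r hr => pow_ne_zero _ (hne r hr))
      (by fun_prop)))
end
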